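/- If the environment is uniformly elliptic, i.e. inf_{k∈ℤ} ω_k > 0, then there exists a constant D > 0 such that (𝒫^t)_{i,j} ≤ D·t^{−1/2} for all (i,j) ∈ ℤ² and all t > 0. In particular, sup_{t≥0} sup_{k∈ℤ} √t · (𝒫^t)_{0,k} < ∞. -/

import Mathlib

open Filter MeasureTheory Topology

/-- `(P^n)_{k,j}` for the balanced walk on `ℤ` with transition probabilities
`P_{k,k-1} = P_{k,k+1} = ω k`, `P_{k,k} = 1 - 2 ω k`. -/
noncomputable def Ppow (ω : ℤ → ℝ) : ℕ → ℤ → ℤ → ℝ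
  | 0, k, j => if k = j then 1 else 0
  | n + 1, k, j =>
      ω k * Ppow ω n (k - 1) j + (1 - 2 * ω k) * Ppow ω n k j + ω k * Ppow ω n (k + 1) j

/-- The continuous-time semigroup `(𝒫^t)_{k,j} = e^{-t} Σ_n t^n/n! (P^n)_{k,j}`. -/
noncomputable def calP (ω : ℤ → ℝ) (t : ℝ) (k j : ℤ) : ℝ :=
  Real.exp (-t) * ∑' n : ℕ, t ^ n / (Nat.factorial n) * Ppow ω n k j

/-- One step of the walk acting on functions. -/
noncomputable def walkStep (ω : ℤ → ℝ) (f : ℤ → ℝ) (k : ℤ) : ℝ :=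
  ω k * f (k - 1) + (1 - 2 * ω k) * f k + ω k * f (k + 1)

theorem support_finite_of_nearest_neighbor {f F : ℤ → ℝ} (hf : f.support.Finite)
    (hF : ∀ k, f (k - 1) = 0 → f k = 0 → f (k + 1) = 0 → F k = 0) : F.support.Finite := by
  refine (((hf.image (· + 1)).union hf).union (hf.image (· - 1))).subset fun k hk => ?_
  by_contra hcon
  simp only [Set.mem_union, Set.mem_image, Function.mem_support, not_or, not_exists, not_and,
    ne_eq, not_not] at hcon
  obtain ⟨⟨h₁, h₂⟩, h₃⟩ := hcon
  refine hk (hF k ?_ h₂ ?_)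
  · by_contra h
    exact h₁ (k - 1) h (by ring)
  · by_contra h
    exact h₃ (k + 1) h (by ring)

theorem summable_of_nearest_neighbor {f F : ℤ → ℝ} (hf : f.support.Finite)
    (hF : ∀ k, f (k - 1) = 0 → f k = 0 → f (k + 1) = 0 → F k = 0) : Summable F :=
  summable_of_hasFiniteSupport (support_finite_of_nearest_neighbor hf hF)

theorem tsum_int_sub_one (f : ℤ → ℝ) : ∑' k, f (k - 1) = ∑' k, f k :=
  (Equiv.subRight (1 : ℤ)).tsum_eq f

theorem tsum_telescope_eq {F G H : ℤ → ℝ} (hG : Summable G) (hH : Summable H)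
    (h : ∀ k, F k = G k + (H (k - 1) - H k)) : ∑' k, F k = ∑' k, G k := by
  have hH' : Summable fun k => H (k - 1) := (Equiv.subRight (1 : ℤ)).summable_iff.mpr hH
  rw [tsum_congr h, hG.tsum_add (hH'.sub hH), hH'.tsum_sub hH, tsum_int_sub_one, sub_self,
    add_zero]

theorem tsum_walkStep {ω f : ℤ → ℝ} (hω : ∀ k, 0 < ω k) (hf : f.support.Finite) :
    ∑' k, (ω k)⁻¹ * walkStep ω f k = ∑' k, (ω k)⁻¹ * f k := by
  refine tsum_telescope_eq (H := fun k => f k - f (k + 1))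
    (summable_of_nearest_neighbor hf (by simp +contextual))
    (summable_of_nearest_neighbor hf (by simp +contextual)) fun k => ?_
  have := (hω k).ne'
  simp only [walkStep, sub_add_cancel]
  field_simp
  ring

theorem tsum_walkStep_mul {ω f g : ℤ → ℝ} (hω : ∀ k, 0 < ω k) (hf : f.support.Finite) :
    ∑' k, (ω k)⁻¹ * (walkStep ω f k * g k) = ∑' k, (ω k)⁻¹ * (f k * walkStep ω g k) := by
  refine tsum_telescope_eq (H := fun k => f k * g (k + 1) - f (k + 1) * g k)
    (summable_of_nearest_neighbor hf (by simp +contextual))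
    (summable_of_nearest_neighbor hf (by simp +contextual)) fun k => ?_
  have := (hω k).ne'
  simp only [walkStep, sub_add_cancel]
  field_simp
  ring

/-- The step-two Dirichlet form of `f` controls the loss of weighted `ℓ²` norm in one step. -/
theorem tsum_walkStep_sq_add_energy_le {ω f : ℤ → ℝ} (hω : ∀ k, 0 < ω k ∧ ω k ≤ 1 / 2)
    (hf : f.support.Finite) :
    ∑' k, (ω k)⁻¹ * walkStep ω f k ^ 2 + 1 / 2 * ∑' k, (f (k + 1) - f (k - 1)) ^ 2
      ≤ ∑' k, (ω k)⁻¹ * f k ^ 2 := by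
  have hG : Summable fun k => (ω k)⁻¹ * f k ^ 2 :=
    summable_of_nearest_neighbor hf (by simp +contextual)
  have hsum := tsum_telescope_eq
    (F := fun k => (ω k)⁻¹ * f k ^ 2 + (f (k + 1) ^ 2 + f (k - 1) ^ 2 - 2 * f k ^ 2))
    (H := fun k => f k ^ 2 - f (k + 1) ^ 2) hG
    (summable_of_nearest_neighbor hf (by simp +contextual))
    (fun k => by simp only [sub_add_cancel]; ring)
  have h₁ : Summable fun k => (ω k)⁻¹ * walkStep ω f k ^ 2 :=
    summable_of_nearest_neighbor hf (by simp +contextual [walkStep])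
  have h₂ : Summable fun k => 1 / 2 * (f (k + 1) - f (k - 1)) ^ 2 :=
    summable_of_nearest_neighbor hf (by simp +contextual)
  rw [← hsum, ← tsum_mul_left, ← h₁.tsum_add h₂]
  refine (h₁.add h₂).tsum_le_tsum (fun k => ?_)
    (summable_of_nearest_neighbor hf (by simp +contextual))
  have hk : (ω k)⁻¹ * walkStep ω f k ^ 2 = (ω k)⁻¹ * f k ^ 2
      + 2 * f k * (f (k - 1) + f (k + 1) - 2 * f k)
      + ω k * (f (k - 1) + f (k + 1) - 2 * f k) ^ 2 := by
    have := (hω k).1.ne'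
    simp only [walkStep]
    field_simp
    ring
  rw [hk]
  nlinarith [mul_le_mul_of_nonneg_right (hω k).2 (sq_nonneg (f (k - 1) + f (k + 1) - 2 * f k))]

theorem sq_le_tsum_abs_sub {f : ℤ → ℝ} (hf : f.support.Finite) (x : ℤ) :
    f x ^ 2 ≤ ∑' k, |f (k + 1) ^ 2 - f (k - 1) ^ 2| := by
  have hs : Summable fun k => |f (k + 1) ^ 2 - f (k - 1) ^ 2| :=
    summable_of_nearest_neighbor hf (by simp +contextual)
  have hinj : Function.Injective fun l : ℕ => x + 2 * (l : ℤ) + 1 := fun a b h => by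
    simp only at h
    omega
  have htel (L : ℕ) : f x ^ 2 - f (x + 2 * L) ^ 2 ≤ ∑' k, |f (k + 1) ^ 2 - f (k - 1) ^ 2| := by
    refine le_trans ?_ (hs.sum_le_tsum ((Finset.range L).map ⟨_, hinj⟩) fun _ _ => abs_nonneg _)
    rw [Finset.sum_map]
    induction L with
    | zero => simp
    | succ L ih =>
      rw [Finset.sum_range_succ]
      have := neg_abs_le (f (x + 2 * L + 1 + 1) ^ 2 - f (x + 2 * L + 1 - 1) ^ 2)
      have e₁ : x + 2 * (L : ℤ) + 1 - 1 = x + 2 * L := by ring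
      have e₂ : x + 2 * ((L + 1 : ℕ) : ℤ) = x + 2 * L + 1 + 1 := by push_cast; ring
      simp only [Function.Embedding.coeFn_mk] at ih ⊢
      rw [e₂]
      rw [e₁] at this ⊢
      linarith
  have hinj' : Function.Injective fun l : ℕ => x + 2 * (l : ℤ) := fun a b h => by
    simp only at h
    omega
  obtain ⟨L, hL⟩ := (hf.preimage hinj'.injOn).exists_notMem
  have hL' : f (x + 2 * L) = 0 := by simpa using hL
  simpa [hL'] using htel L

/-- Agmon-type inequality with a free parameter. -/
theorem sq_le_energy_add_norm {ω f : ℤ → ℝ} (hω : ∀ k, 0 < ω k ∧ ω k ≤ 1 / 2)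
    (hf : f.support.Finite) {s : ℝ} (hs : 0 < s) (x : ℤ) :
    f x ^ 2 ≤ s / 2 * ∑' k, (f (k + 1) - f (k - 1)) ^ 2 + s⁻¹ * ∑' k, (ω k)⁻¹ * f k ^ 2 := by
  have h₁ : Summable fun k => s / 2 * (f (k + 1) - f (k - 1)) ^ 2 :=
    summable_of_nearest_neighbor hf (by simp +contextual)
  have h₂ : Summable fun k => s⁻¹ * ((ω k)⁻¹ * f k ^ 2) :=
    summable_of_nearest_neighbor hf (by simp +contextual)
  rw [← tsum_mul_left, ← tsum_mul_left, ← h₁.tsum_add h₂]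
  have hshift := tsum_telescope_eq
    (F := fun k => s / 2 * (f (k + 1) - f (k - 1)) ^ 2 + s⁻¹ * ((ω k)⁻¹ * f k ^ 2)
      + s⁻¹ * (f (k + 1) ^ 2 + f (k - 1) ^ 2 - 2 * f k ^ 2))
    (H := fun k => s⁻¹ * (f k ^ 2 - f (k + 1) ^ 2)) (h₁.add h₂)
    (summable_of_nearest_neighbor hf (by simp +contextual))
    (fun k => by simp only [sub_add_cancel]; ring)
  rw [← hshift]
  refine (sq_le_tsum_abs_sub hf x).trans (Summable.tsum_le_tsum (fun k => ?_)
    (summable_of_nearest_neighbor hf (by simp +contextual))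
    (summable_of_nearest_neighbor hf (by simp +contextual)))
  have hω2 : 2 ≤ (ω k)⁻¹ := by
    rw [le_inv_comm₀ two_pos (hω k).1]
    linarith [(hω k).2]
  have hyoung (d e : ℝ) : d * e ≤ s / 2 * d ^ 2 + s⁻¹ / 2 * e ^ 2 := by
    have : s / 2 * d ^ 2 + s⁻¹ / 2 * e ^ 2 - d * e = s⁻¹ / 2 * (s * d - e) ^ 2 := by
      field_simp
      ring
    have : 0 ≤ s⁻¹ / 2 * (s * d - e) ^ 2 := by positivity
    linarith
  have hsi : 0 < s⁻¹ := inv_pos.mpr hs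
  have hm : s⁻¹ * (2 * f k ^ 2) ≤ s⁻¹ * ((ω k)⁻¹ * f k ^ 2) := by gcongr
  have hsq : s⁻¹ / 2 * (f (k + 1) + f (k - 1)) ^ 2 ≤ s⁻¹ * (f (k + 1) ^ 2 + f (k - 1) ^ 2) := by
    nlinarith [mul_nonneg hsi.le (sq_nonneg (f (k + 1) - f (k - 1)))]
  rw [abs_le]
  constructor
  · have := hyoung (-(f (k + 1) - f (k - 1))) (f (k + 1) + f (k - 1))
    linarith
  · have := hyoung (f (k + 1) - f (k - 1)) (f (k + 1) + f (k - 1))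
    linarith

/-- Nash inequality for finitely supported nonnegative functions of weighted mass at most `c⁻¹`. -/
theorem nash_inequality {ω f : ℤ → ℝ} (hω : ∀ k, 0 < ω k ∧ ω k ≤ 1 / 2)
    (hf : f.support.Finite) (hf0 : ∀ k, 0 ≤ f k) {c : ℝ} (hc : 0 < c)
    (hmass : ∑' k, (ω k)⁻¹ * f k ≤ c⁻¹) :
    c ^ 4 / 2 * (∑' k, (ω k)⁻¹ * f k ^ 2) ^ 3 ≤ ∑' k, (f (k + 1) - f (k - 1)) ^ 2 := by
  have hω0 (k) : 0 ≤ (ω k)⁻¹ := inv_nonneg.mpr (hω k).1.le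
  set a := ∑' k, (ω k)⁻¹ * f k ^ 2 with ha
  set E := ∑' k, (f (k + 1) - f (k - 1)) ^ 2 with hE
  have hE0 : 0 ≤ E := tsum_nonneg fun k => sq_nonneg _
  have ha0 : 0 ≤ a := tsum_nonneg fun k => mul_nonneg (hω0 k) (sq_nonneg _)
  rcases ha0.eq_or_lt with h0 | hpos
  · rw [← h0]
    simpa using hE0
  set s : ℝ := 2 / (a * c ^ 2) with hs
  have hs0 : 0 < s := by positivity
  set B := s / 2 * E + s⁻¹ * a with hB
  have hB0 : 0 ≤ B := by positivity
  have hsup (x) : f x ≤ √B := Real.le_sqrt_of_sq_le (sq_le_energy_add_norm hω hf hs0 x)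
  have hle : a ≤ √B * c⁻¹ := by
    refine le_trans ?_ (mul_le_mul_of_nonneg_left hmass (Real.sqrt_nonneg B))
    rw [ha, ← tsum_mul_left]
    refine Summable.tsum_le_tsum (fun k => ?_)
      (summable_of_nearest_neighbor hf (by simp +contextual))
      (summable_of_nearest_neighbor hf (by simp +contextual))
    calc (ω k)⁻¹ * f k ^ 2 = f k * ((ω k)⁻¹ * f k) := by ring
      _ ≤ √B * ((ω k)⁻¹ * f k) :=
        mul_le_mul_of_nonneg_right (hsup k) (mul_nonneg (hω0 k) (hf0 k))
  have hsq : a ^ 2 ≤ B * c⁻¹ ^ 2 := by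
    calc a ^ 2 ≤ (√B * c⁻¹) ^ 2 := pow_le_pow_left₀ ha0 hle 2
      _ = B * c⁻¹ ^ 2 := by rw [mul_pow, Real.sq_sqrt hB0]
  have hBval : B * c⁻¹ ^ 2 = E / (a * c ^ 4) + a ^ 2 / 2 := by
    rw [hB, hs]
    field_simp
  have hfin : a ^ 2 / 2 ≤ E / (a * c ^ 4) := by linarith
  rw [le_div_iff₀ (by positivity)] at hfin
  linarith

theorem Ppow_succ_eq_walkStep (ω : ℤ → ℝ) (n : ℕ) (j : ℤ) :
    (fun k => Ppow ω (n + 1) k j) = walkStep ω fun k => Ppow ω n k j := rfl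

theorem Ppow_support_finite (ω : ℤ → ℝ) (n : ℕ) (j : ℤ) :
    (Function.support fun k => Ppow ω n k j).Finite := by
  induction n with
  | zero => exact (Set.finite_singleton j).subset fun k hk => by simpa [Ppow] using hk
  | succ n ih => exact support_finite_of_nearest_neighbor ih (by simp +contextual [Ppow])

theorem Ppow_nonneg {ω : ℤ → ℝ} (hω : ∀ k, 0 < ω k ∧ ω k ≤ 1 / 2) (n : ℕ) (k j : ℤ) :
    0 ≤ Ppow ω n k j := by
  induction n generalizing k with
  | zero => simp only [Ppow]; split_ifs <;> norm_num
  | succ n ih =>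
    have h₁ := mul_nonneg (hω k).1.le (ih (k - 1))
    have h₂ := mul_nonneg (hω k).1.le (ih (k + 1))
    have h₃ : 0 ≤ (1 - 2 * ω k) * Ppow ω n k j :=
      mul_nonneg (by linarith [(hω k).2]) (ih k)
    simp only [Ppow]
    linarith

theorem tsum_Ppow {ω : ℤ → ℝ} (hω : ∀ k, 0 < ω k) (n : ℕ) (j : ℤ) :
    ∑' k, (ω k)⁻¹ * Ppow ω n k j = (ω j)⁻¹ := by
  induction n with
  | zero => simp [Ppow]
  | succ n ih => rw [← ih]; exact tsum_walkStep hω (Ppow_support_finite ω n j)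

theorem tsum_Ppow_mul_Ppow {ω : ℤ → ℝ} (hω : ∀ k, 0 < ω k) (n r : ℕ) (i j : ℤ) :
    ∑' k, (ω k)⁻¹ * (Ppow ω n k i * Ppow ω r k j) = (ω i)⁻¹ * Ppow ω (n + r) i j := by
  induction n generalizing r with
  | zero => simp [Ppow]
  | succ n ih =>
    rw [show n + 1 + r = n + (r + 1) by ring, ← ih (r + 1)]
    exact tsum_walkStep_mul hω (Ppow_support_finite ω n i)

/-- On-diagonal decay of the weighted `ℓ²` norm. -/
theorem tsum_Ppow_sq_decay {ω : ℤ → ℝ} (hω : ∀ k, 0 < ω k ∧ ω k ≤ 1 / 2) {c : ℝ} (hc : 0 < c)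
    (hcω : ∀ k, c ≤ ω k) (n : ℕ) (j : ℤ) :
    (∑' k, (ω k)⁻¹ * Ppow ω n k j ^ 2) ^ 2 * (c ^ 4 / 4 * (n + 1)) ≤ 1 := by
  have hω0 (k) : 0 ≤ (ω k)⁻¹ := inv_nonneg.mpr (hω k).1.le
  have hj : (ω j)⁻¹ ≤ c⁻¹ := inv_anti₀ hc (hcω j)
  induction n with
  | zero =>
    have hc2 : c ≤ 1 / 2 := (hcω 0).trans (hω 0).2
    have h0 : ∑' k, (ω k)⁻¹ * Ppow ω 0 k j ^ 2 = (ω j)⁻¹ := by simp [Ppow]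
    rw [h0]
    calc (ω j)⁻¹ ^ 2 * (c ^ 4 / 4 * ((0 : ℕ) + 1))
        ≤ c⁻¹ ^ 2 * (c ^ 4 / 4 * ((0 : ℕ) + 1)) := by
          have := hω0 j
          gcongr
      _ = c ^ 2 / 4 := by field_simp; simp
      _ ≤ 1 := by nlinarith
  | succ n ih =>
    have hf := Ppow_support_finite ω n j
    have hstep := tsum_walkStep_sq_add_energy_le hω hf
    have hnash := nash_inequality hω hf (fun k => Ppow_nonneg hω n k j) hc
      ((tsum_Ppow (fun k => (hω k).1) n j).trans_le hj)
    rw [← Ppow_succ_eq_walkStep] at hstep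
    set a := ∑' k, (ω k)⁻¹ * Ppow ω n k j ^ 2
    set b := ∑' k, (ω k)⁻¹ * Ppow ω (n + 1) k j ^ 2
    have hb0 : 0 ≤ b := tsum_nonneg fun k => mul_nonneg (hω0 k) (sq_nonneg _)
    set q : ℝ := c ^ 4 / 4 with hq
    have hq0 : 0 < q := by positivity
    have hba : b ≤ a * (1 - q * a ^ 2) := by
      rw [hq]
      linarith
    have hu0 : 0 ≤ q * a ^ 2 := by positivity
    have hun : q * a ^ 2 * (n + 1) ≤ 1 := by linarith
    have hu1 : q * a ^ 2 ≤ 1 := by nlinarith [mul_nonneg hu0 n.cast_nonneg]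
    have hb2 : b ^ 2 ≤ a ^ 2 * (1 - q * a ^ 2) := by
      calc b ^ 2 ≤ (a * (1 - q * a ^ 2)) ^ 2 := pow_le_pow_left₀ hb0 hba 2
        _ = a ^ 2 * ((1 - q * a ^ 2) * (1 - q * a ^ 2)) := by ring
        _ ≤ a ^ 2 * (1 - q * a ^ 2) := by
          gcongr
          nlinarith
    calc b ^ 2 * (q * ((n + 1 : ℕ) + 1))
        ≤ a ^ 2 * (1 - q * a ^ 2) * (q * ((n + 1 : ℕ) + 1)) := by gcongr
      _ = (1 - q * a ^ 2) * (q * a ^ 2 * (n + 1) + q * a ^ 2) := by push_cast; ring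
      _ ≤ (1 - q * a ^ 2) * (1 + q * a ^ 2) := by
        have : 0 ≤ 1 - q * a ^ 2 := by linarith
        gcongr
      _ ≤ 1 := by nlinarith [sq_nonneg (q * a ^ 2)]

/-- Discrete-time heat-kernel bound `P^n ≲ (n + 1)^{-1/2}`, linearised by Young's inequality. -/
theorem Ppow_le {ω : ℤ → ℝ} (hω : ∀ k, 0 < ω k ∧ ω k ≤ 1 / 2) {c : ℝ} (hc : 0 < c)
    (hcω : ∀ k, c ≤ ω k) {s : ℝ} (hs : 0 < s) (n : ℕ) (i j : ℤ) :
    Ppow ω n i j ≤ s⁻¹ + s * (4 / c ^ 4) * (1 / (n + 1)) := by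
  have hω0 (k) : 0 ≤ (ω k)⁻¹ := inv_nonneg.mpr (hω k).1.le
  have hnorm (r : ℕ) (hr : n ≤ 2 * r + 1) (j : ℤ) :
      ∑' k, (ω k)⁻¹ * Ppow ω r k j ^ 2 ≤ s⁻¹ + s * (4 / c ^ 4) * (1 / (n + 1)) := by
    have hdec := tsum_Ppow_sq_decay hω hc hcω r j
    set a := ∑' k, (ω k)⁻¹ * Ppow ω r k j ^ 2
    have hnr : ((n : ℝ) + 1) / 2 ≤ r + 1 := by
      have : (n : ℝ) ≤ 2 * r + 1 := by exact_mod_cast hr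
      linarith
    have hsq : a ^ 2 ≤ 2 * (4 / c ^ 4 * (1 / (n + 1))) := by
      have h1 : a ^ 2 * (c ^ 4 / 4 * (((n : ℝ) + 1) / 2)) ≤ 1 := le_trans (by gcongr) hdec
      rw [← le_div_iff₀ (by positivity)] at h1
      refine h1.trans_eq ?_
      field_simp
    have hyoung : a ≤ s⁻¹ / 2 + s / 2 * a ^ 2 := by
      have : s⁻¹ / 2 + s / 2 * a ^ 2 - a = s⁻¹ / 2 * (s * a - 1) ^ 2 := by
        field_simp
        ring
      have : 0 ≤ s⁻¹ / 2 * (s * a - 1) ^ 2 := by positivity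
      linarith
    have hsi : 0 < s⁻¹ := inv_pos.mpr hs
    have := mul_le_mul_of_nonneg_left hsq (half_pos hs).le
    linarith
  have h₁ := hnorm (n / 2) (by omega) i
  have h₂ := hnorm (n - n / 2) (by omega) j
  have hprod := tsum_Ppow_mul_Ppow (fun k => (hω k).1) (n / 2) (n - n / 2) i j
  rw [show n / 2 + (n - n / 2) = n by omega] at hprod
  have hs₁ : Summable fun k => (ω k)⁻¹ * Ppow ω (n / 2) k i ^ 2 :=
    summable_of_nearest_neighbor (Ppow_support_finite ω (n / 2) i) (by simp +contextual)
  have hs₂ : Summable fun k => (ω k)⁻¹ * Ppow ω (n - n / 2) k j ^ 2 :=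
    summable_of_nearest_neighbor (Ppow_support_finite ω (n - n / 2) j) (by simp +contextual)
  have hs₃ : Summable fun k => (ω k)⁻¹ * (Ppow ω (n / 2) k i * Ppow ω (n - n / 2) k j) :=
    summable_of_nearest_neighbor (Ppow_support_finite ω (n / 2) i) (by simp +contextual)
  have hcs := (hs₃.mul_left 2).tsum_le_tsum (fun k => by
    have := mul_nonneg (hω0 k) (sq_nonneg (Ppow ω (n / 2) k i - Ppow ω (n - n / 2) k j))
    linarith) (hs₁.add hs₂)
  rw [tsum_mul_left, hs₁.tsum_add hs₂, hprod] at hcs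
  have hω1 : 1 ≤ (ω i)⁻¹ := (one_le_inv₀ (hω i).1).mpr (by linarith [(hω i).2])
  have := mul_le_mul_of_nonneg_right hω1 (Ppow_nonneg hω n i j)
  linarith

theorem hasSum_pow_div_factorial (t : ℝ) :
    HasSum (fun n : ℕ => t ^ n / n.factorial) (Real.exp t) := by
  rw [Real.exp_eq_exp_ℝ]
  exact NormedSpace.expSeries_div_hasSum_exp t

theorem hasSum_poisson_inv_succ {t : ℝ} (ht : t ≠ 0) :
    HasSum (fun n : ℕ => t ^ n / n.factorial * (1 / (n + 1))) ((Real.exp t - 1) / t) := by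
  have hterm (n : ℕ) :
      t ^ n / n.factorial * (1 / (n + 1)) = t ^ (n + 1) / (n + 1).factorial / t := by
    rw [Nat.factorial_succ]
    push_cast
    have : (n.factorial : ℝ) ≠ 0 := by positivity
    field_simp
    ring
  simp only [hterm]
  simpa using ((hasSum_nat_add_iff' 1).mpr (hasSum_pow_div_factorial t)).div_const t

theorem calP_le {ω : ℤ → ℝ} (hω : ∀ k, 0 < ω k ∧ ω k ≤ 1 / 2) {c : ℝ} (hc : 0 < c)
    (hcω : ∀ k, c ≤ ω k) {t : ℝ} (ht : 0 < t) (i j : ℤ) :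
    calP ω t i j ≤ (1 + 4 / c ^ 4) * (√t)⁻¹ := by
  have hst : 0 < √t := Real.sqrt_pos.mpr ht
  have hbound := ((hasSum_pow_div_factorial t).mul_right (√t)⁻¹).add
    ((hasSum_poisson_inv_succ ht.ne').mul_left (√t * (4 / c ^ 4)))
  have hterm (n : ℕ) : t ^ n / n.factorial * Ppow ω n i j ≤ t ^ n / n.factorial * (√t)⁻¹
      + √t * (4 / c ^ 4) * (t ^ n / n.factorial * (1 / (n + 1))) := by
    have := mul_le_mul_of_nonneg_left (Ppow_le hω hc hcω hst n i j)
      (by positivity : 0 ≤ t ^ n / n.factorial)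
    linarith
  have hsum : Summable fun n : ℕ => t ^ n / n.factorial * Ppow ω n i j :=
    Summable.of_nonneg_of_le
      (fun n => mul_nonneg (by positivity) (Ppow_nonneg hω n i j)) hterm hbound.summable
  calc calP ω t i j
      ≤ Real.exp (-t) * (Real.exp t * (√t)⁻¹ + √t * (4 / c ^ 4) * ((Real.exp t - 1) / t)) :=
        mul_le_mul_of_nonneg_left (hasSum_le hterm hsum.hasSum hbound) (Real.exp_pos _).le
    _ ≤ Real.exp (-t) * (Real.exp t * (√t)⁻¹ + √t * (4 / c ^ 4) * (Real.exp t / t)) := by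
        gcongr
        linarith
    _ = Real.exp (-t) * Real.exp t * ((√t)⁻¹ + 4 / c ^ 4 * (√t / t)) := by ring
    _ = (1 + 4 / c ^ 4) * (√t)⁻¹ := by
        rw [← Real.exp_add, neg_add_cancel, Real.exp_zero, Real.sqrt_div_self]
        ring

/-- **Lemma 3 (heat-kernel bound, continuous time).**  If the environment is uniformly
elliptic, i.e. `inf_k ω_k > 0`, then there is `D > 0` with `(𝒫^t)_{i,j} ≤ D t^{-1/2}`
for all `i, j ∈ ℤ` and `t > 0`; in particular `sup_{t ≥ 0} sup_k √t (𝒫^t)_{0,k} < ∞`. -/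
theorem heat_kernel_bound_continuous
    (ω : ℤ → ℝ) (hω : ∀ k : ℤ, 0 < ω k ∧ ω k ≤ 1 / 2)
    (hell : ∃ c : ℝ, 0 < c ∧ ∀ k : ℤ, c ≤ ω k) :
    (∃ D : ℝ, 0 < D ∧ ∀ i j : ℤ, ∀ t : ℝ, 0 < t → calP ω t i j ≤ D * t ^ (-(1:ℝ)/2))
    ∧ (∃ M : ℝ, ∀ t : ℝ, 0 ≤ t → ∀ k : ℤ, Real.sqrt t * calP ω t 0 k ≤ M) := by
  obtain ⟨c, hc, hcω⟩ := hell
  have hD : 0 < 1 + 4 / c ^ 4 := by positivity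
  refine ⟨⟨_, hD, fun i j t ht => ?_⟩, ⟨1 + 4 / c ^ 4, fun t ht k => ?_⟩⟩
  · rw [neg_div, Real.rpow_neg ht.le, ← Real.sqrt_eq_rpow]
    exact calP_le hω hc hcω ht i j
  · rcases ht.eq_or_lt with rfl | ht
    · simpa using hD.le
    · have hst : 0 < √t := Real.sqrt_pos.mpr ht
      calc √t * calP ω t 0 k ≤ √t * ((1 + 4 / c ^ 4) * (√t)⁻¹) :=
            mul_le_mul_of_nonneg_left (calP_le hω hc hcω ht 0 k) hst.le
        _ = 1 + 4 / c ^ 4 := by field_simp
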